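/- Let v1, v2 be natural numbers with gcd(4, v1) = 2, v2 odd and v2 > 2·v1. Then every natural number n ≥ v1 + v2 − 3 belongs to the numerical semigroup ⟨4, v1, v2⟩, the number v1 + v2 − 4 does not belong to ⟨4, v1, v2⟩ (so the conductor of ⟨4, v1, v2⟩ is v1 + v2 − 3), and the gaps of ⟨4, v1, v2⟩ that are greater than v1 are exactly the numbers v2 − 4j for 1 ≤ j ≤ ⌊(v2 − v1)/4⌋ together with the numbers v2 + v1 − 4j for 1 ≤ j ≤ ⌊v2/4⌋. -/

import Mathlib

theorem mem_closure_aux (v1 v2 : ℕ) (h1 : v1 % 4 = 2) (h2 : v2 % 2 = 1)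
    (hv : 2 * v1 < v2) (n : ℕ) :
    n ∈ AddSubmonoid.closure ({4, v1, v2} : Set ℕ) ↔
      (n % 4 = 0 ∨ (v1 ≤ n ∧ n % 4 = 2) ∨ (v2 ≤ n ∧ n % 4 = v2 % 4) ∨
        (v1 + v2 ≤ n ∧ n % 4 = (v1 + v2) % 4)) := by
  constructor
  · intro h
    induction h using AddSubmonoid.closure_induction with
    | mem x hx =>
      simp only [Set.mem_insert_iff, Set.mem_singleton_iff] at hx
      omega
    | zero => left; rfl
    | add x y _ _ hx hy => omega
  · have m4 : 4 ∈ AddSubmonoid.closure ({4, v1, v2} : Set ℕ) :=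
      AddSubmonoid.subset_closure (by simp)
    have m1 : v1 ∈ AddSubmonoid.closure ({4, v1, v2} : Set ℕ) :=
      AddSubmonoid.subset_closure (by simp)
    have m2 : v2 ∈ AddSubmonoid.closure ({4, v1, v2} : Set ℕ) :=
      AddSubmonoid.subset_closure (by simp)
    have key : ∀ a ∈ AddSubmonoid.closure ({4, v1, v2} : Set ℕ), a ≤ n → n % 4 = a % 4 →
        n ∈ AddSubmonoid.closure ({4, v1, v2} : Set ℕ) := by
      intro a ha hle hmod
      have e : n = a + ((n - a) / 4) • 4 := by
        rw [smul_eq_mul]; omega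
      rw [e]
      exact add_mem ha (nsmul_mem m4 _)
    rintro (h | ⟨h, h'⟩ | ⟨h, h'⟩ | ⟨h, h'⟩)
    · exact key 0 (zero_mem _) (Nat.zero_le _) h
    · exact key v1 m1 h (by omega)
    · exact key v2 m2 h h'
    · exact key _ (add_mem m1 m2) h h'

/-- The gaps of the numerical semigroup `⟨4, v₁, v₂⟩` (with `gcd(4, v₁) = 2`,
`v₂` odd, `v₂ > 2v₁`) above `v₁` are exactly the numbers `v₂ - 4j` for
`1 ≤ j ≤ ⌊(v₂-v₁)/4⌋` together with `v₂ + v₁ - 4j` for `1 ≤ j ≤ ⌊v₂/4⌋`, and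
the conductor is `v₁ + v₂ - 3`. -/
theorem stmt_11 (v1 v2 : ℕ) (hgcd : Nat.gcd 4 v1 = 2) (hodd : Odd v2)
    (hv : 2 * v1 < v2) :
    (∀ n : ℕ, v1 + v2 - 3 ≤ n → n ∈ AddSubmonoid.closure ({4, v1, v2} : Set ℕ)) ∧
    (v1 + v2 - 4) ∉ AddSubmonoid.closure ({4, v1, v2} : Set ℕ) ∧
    (∀ n : ℕ, v1 < n →
      (n ∉ AddSubmonoid.closure ({4, v1, v2} : Set ℕ) ↔
        ((∃ j : ℕ, 1 ≤ j ∧ j ≤ (v2 - v1) / 4 ∧ n = v2 - 4 * j) ∨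
         (∃ j : ℕ, 1 ≤ j ∧ j ≤ v2 / 4 ∧ n = v2 + v1 - 4 * j)))) := by
  have h1 : v1 % 4 = 2 := by
    have hlt : v1 % 4 < 4 := Nat.mod_lt _ (by norm_num)
    have hg : Nat.gcd (v1 % 4) 4 = 2 := by
      rw [← Nat.gcd_rec]; exact hgcd
    generalize v1 % 4 = r at *
    interval_cases r <;> simp_all
  have h2 : v2 % 2 = 1 := Nat.odd_iff.mp hodd
  simp only [mem_closure_aux v1 v2 h1 h2 hv]
  refine ⟨fun n hn => by omega, by omega, fun n hn => ⟨fun h => ?_, ?_⟩⟩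
  · by_cases hc : n % 4 = v2 % 4
    · exact Or.inl ⟨(v2 - n) / 4, by omega, by omega, by omega⟩
    · exact Or.inr ⟨(v1 + v2 - n) / 4, by omega, by omega, by omega⟩
  · rintro (⟨j, hj, hj', rfl⟩ | ⟨j, hj, hj', rfl⟩) <;> omega
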